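/- Let X be shifted Borel with mean μ, so λ = μ/(1+μ), P(X=0) = e^{−μ/(1+μ)} and Var[X] = μ(1+μ)². With c = −e^{−μ/(1+μ)}/(1+μ)², Var[cX − 1_{X=0}] = e^{−2μ/(1+μ)}( e^{μ/(1+μ)} − 1 − μ/(1+μ)² ). -/

import Mathlib

open MeasureTheory ProbabilityTheory

lemma hasSum_of_eq {f g : ℕ → ℝ} {a b : ℝ} (h : HasSum f a) (hfg : ∀ n, g n = f n) (hab : b = a) :
    HasSum g b := by
  have : g = f := funext hfg
  rw [this, hab]; exact h

noncomputable def treeT (i : ℕ) : ℝ := if i = 0 then 0 else (i : ℝ) ^ (i - 1) / (Nat.factorial i : ℝ)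

lemma treeT_inner (m : ℕ) :
    ∑ p ∈ Finset.HasAntidiagonal.antidiagonal m, treeT p.1 * ((-(p.1 : ℝ)) ^ p.2 / (Nat.factorial p.2 : ℝ))
      = if m = 1 then 1 else 0 := by
  by_cases h0 : m = 0
  · subst h0; simp [treeT]
  by_cases h1 : m = 1
  · subst h1; simp [treeT, Finset.Nat.antidiagonal_succ]
  rw [if_neg h1]
  have key := congrFun (fwdDiff_iter_pow_eq_zero_of_lt (R := ℝ) (j := m - 1) (n := m) (by omega)) 0
  rw [fwdDiff_iter_eq_sum_shift] at key
  rw [Finset.Nat.sum_antidiagonal_eq_sum_range_succ_mk]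
  have hm : (Nat.factorial m : ℝ) ≠ 0 := by positivity
  rw [← mul_right_inj' hm, mul_zero, Finset.mul_sum]
  rw [Pi.zero_apply] at key
  rw [← key]
  apply Finset.sum_congr rfl
  intro i hi
  have him : i ≤ m := by simpa [Nat.lt_succ_iff] using hi
  by_cases hi0 : i = 0
  · subst hi0
    have : m - 1 ≠ 0 := by omega
    simp [treeT, this]
  · have hc : (m.choose i : ℝ) * (Nat.factorial i) * (Nat.factorial (m - i)) = Nat.factorial m := by
      exact_mod_cast Nat.choose_mul_factorial_mul_factorial him
    have hp : (i : ℝ) ^ (m - 1) = (i : ℝ) ^ (i - 1) * (i : ℝ) ^ (m - i) := by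
      rw [← pow_add]; congr 1; omega
    simp only [treeT, if_neg hi0, zsmul_eq_mul, zero_add, nsmul_eq_mul, mul_one]
    push_cast
    rw [hp, ← hc, neg_pow (i : ℝ)]
    field_simp

lemma abel_id (n : ℕ) :
    ∑ p ∈ Finset.HasAntidiagonal.antidiagonal n, treeT p.1 * ((p.2 : ℝ) ^ p.2 / (Nat.factorial p.2 : ℝ))
      = if n = 0 then 0 else (n : ℝ) ^ n / (Nat.factorial n : ℝ) := by
  have e1 : ∀ p ∈ Finset.HasAntidiagonal.antidiagonal n,
      treeT p.1 * ((p.2 : ℝ) ^ p.2 / (Nat.factorial p.2 : ℝ)) =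
      ∑ q ∈ Finset.HasAntidiagonal.antidiagonal p.2, treeT p.1 * (((-(p.1 : ℝ)) ^ q.1 / (Nat.factorial q.1 : ℝ)) *
        ((n : ℝ) ^ q.2 / (Nat.factorial q.2 : ℝ))) := by
    intro p hp
    have hp' : p.1 + p.2 = n := by simpa using hp
    rw [← Finset.mul_sum]
    congr 1
    have : (p.2 : ℝ) = -(p.1 : ℝ) + n := by rw [← hp']; push_cast; ring
    have h2 : (p.2 : ℝ) ^ p.2 = (-(p.1 : ℝ) + n) ^ p.2 := by rw [← this]
    rw [h2, (Commute.all _ _).add_pow', Finset.sum_div]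
    apply Finset.sum_congr rfl
    intro q hq
    have hq' : q.1 + q.2 = p.2 := by simpa using hq
    have hc : (p.2.choose q.1 : ℝ) * (Nat.factorial q.1) * (Nat.factorial q.2)
        = Nat.factorial p.2 := by
      have := Nat.add_choose_mul_factorial_mul_factorial q.1 q.2
      rw [← Nat.choose_symm_add, hq'] at this
      exact_mod_cast this
    have : (p.2.choose q.1 : ℝ) ≠ 0 := by
      have := Nat.choose_pos (n := p.2) (k := q.1) (by omega)
      positivity
    rw [nsmul_eq_mul, ← hc]
    field_simp
  rw [Finset.sum_congr rfl e1, Finset.sum_sigma']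
  have e2 : ∑ p ∈ Finset.HasAntidiagonal.antidiagonal n, ∑ q ∈ Finset.HasAntidiagonal.antidiagonal p.1,
      treeT q.1 * (((-(q.1 : ℝ)) ^ q.2 / (Nat.factorial q.2 : ℝ)) *
        ((n : ℝ) ^ p.2 / (Nat.factorial p.2 : ℝ))) =
      if n = 0 then 0 else (n : ℝ) ^ n / (Nat.factorial n : ℝ) := by
    have : ∀ p ∈ Finset.HasAntidiagonal.antidiagonal n, ∑ q ∈ Finset.HasAntidiagonal.antidiagonal p.1,
      treeT q.1 * (((-(q.1 : ℝ)) ^ q.2 / (Nat.factorial q.2 : ℝ)) *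
        ((n : ℝ) ^ p.2 / (Nat.factorial p.2 : ℝ))) = (if p.1 = 1 then 1 else 0) *
        ((n : ℝ) ^ p.2 / (Nat.factorial p.2 : ℝ)) := by
      intro p _
      rw [← treeT_inner, Finset.sum_mul]
      exact Finset.sum_congr rfl fun _ _ => by ring
    rw [Finset.sum_congr rfl this]
    rcases n with _ | n
    · simp
    · rw [Finset.sum_eq_single (1, n)]
      · simp only [if_true, one_mul, Nat.factorial_succ]
        rw [if_neg (by omega)]
        push_cast
        have : (n : ℝ) + 1 ≠ 0 := by positivity
        field_simp
        ring
      · rintro ⟨a, b⟩ hb hne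
        have : a + b = n + 1 := by simpa using hb
        rw [if_neg, zero_mul]
        rintro h
        apply hne
        simp only at h
        ext <;> simp <;> omega
      · intro h; exact absurd (by simp; omega) h
  rw [← e2, Finset.sum_sigma']
  refine Finset.sum_bij' (fun x _ => ⟨(x.1.1 + x.2.1, x.2.2), (x.1.1, x.2.1)⟩)
    (fun x _ => ⟨(x.2.1, x.2.2 + x.1.2), (x.2.2, x.1.2)⟩) ?_ ?_ ?_ ?_ ?_
  · rintro ⟨⟨a, b⟩, ⟨c, d⟩⟩ h
    simp at h ⊢; omega
  · rintro ⟨⟨a, b⟩, ⟨c, d⟩⟩ h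
    simp at h ⊢; omega
  · rintro ⟨⟨a, b⟩, ⟨c, d⟩⟩ h
    simp at h ⊢; omega
  · rintro ⟨⟨a, b⟩, ⟨c, d⟩⟩ h
    simp at h ⊢; omega
  · rintro ⟨⟨a, b⟩, ⟨c, d⟩⟩ h
    rfl

set_option maxHeartbeats 1000000 in
/-- summation consequences -/
lemma tree_sums (l z : ℝ) (hl0 : 0 ≤ l) (hl1 : l < 1) (hz : z = l * Real.exp (-l))
    (hT : HasSum (fun n : ℕ => treeT n * z ^ n) l) :
    HasSum (fun n : ℕ => (n : ℝ) ^ n / (Nat.factorial n : ℝ) * z ^ n) (1 / (1 - l)) ∧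
    HasSum (fun n : ℕ => n * ((n : ℝ) ^ n / (Nat.factorial n : ℝ) * z ^ n)) (l / (1 - l) ^ 3) := by
  have hz0 : 0 ≤ z := by rw [hz]; positivity
  set r := Real.exp 1 * z with hr
  have hr0 : 0 ≤ r := by positivity
  have hr1 : r < 1 := by
    have h := Real.add_one_lt_exp (x := l - 1) (by linarith)
    have : r * Real.exp (l - 1) = l := by
      have e : Real.exp 1 * Real.exp (-l) * Real.exp (l - 1) = 1 := by
        rw [← Real.exp_add, ← Real.exp_add]; ring_nf; simp
      rw [hr, hz]
      linear_combination l * e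
    have h3 := Real.exp_pos (l - 1)
    by_contra hcon
    nlinarith
  set a : ℕ → ℝ := fun n : ℕ => (n : ℝ) ^ n / (Nat.factorial n : ℝ) * z ^ n with ha
  have ha0 : ∀ n, 0 ≤ a n := fun n => by simp only [ha]; positivity
  have hale : ∀ n, a n ≤ r ^ n := fun n => by
    have := Real.pow_div_factorial_le_exp (x := n) (by positivity) n
    simp only [ha, hr, mul_pow, ← Real.exp_nat_mul, mul_one]
    gcongr
  have hnr : ‖r‖ < 1 := by rwa [Real.norm_of_nonneg hr0]
  have sB : Summable (fun n : ℕ => n * a n) := by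
    refine Summable.of_nonneg_of_le (fun n => mul_nonneg (by positivity) (ha0 n)) (fun n => ?_)
      (summable_pow_mul_geometric_of_norm_lt_one 1 hnr)
    rw [pow_one]
    have := hale n
    gcongr
  have sA : Summable a := Summable.of_nonneg_of_le ha0 hale (summable_geometric_of_lt_one hr0 hr1)
  set t : ℕ → ℝ := fun n => treeT n * z ^ n with ht
  have ht0 : ∀ n, 0 ≤ t n := fun n => by
    simp only [ht, treeT]; split_ifs <;> positivity
  have sT : Summable t := hT.summable
  have hconv : ∀ n, ∑ p ∈ Finset.HasAntidiagonal.antidiagonal n, t p.1 * a p.2 = if n = 0 then 0 else a n := by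
    intro n
    have := congrArg (· * z ^ n) (abel_id n)
    simp only [Finset.sum_mul] at this
    calc _ = _ := Finset.sum_congr rfl fun p hp => ?_
      _ = _ := this
      _ = _ := by split_ifs <;> simp [ha]
    have hp' : p.1 + p.2 = n := by simpa using hp
    simp only [ht, ha]
    rw [← hp', pow_add]; ring
  have ntA : ∀ n : ℕ, n * t n = if n = 0 then 0 else a n := by
    intro n
    by_cases h : n = 0
    · simp [h]
    · simp only [ht, ha, treeT, if_neg h]
      obtain ⟨k, rfl⟩ := Nat.exists_eq_succ_of_ne_zero h
      simp only [Nat.succ_eq_add_one, Nat.add_sub_cancel]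
      rw [pow_succ ((k + 1 : ℕ) : ℝ) k]; ring
  have sumA' : HasSum (fun n => if n = 0 then 0 else a n) ((∑' n, a n) - 1) := by
    have h := sA.hasSum.update 0 0
    have h0 : a 0 = 1 := by simp [ha]
    rw [h0] at h
    refine hasSum_of_eq h (fun n => ?_) (by ring)
    simp [Function.update_apply]
  have nrm : ∀ {f : ℕ → ℝ}, Summable f → Summable (fun n => ‖f n‖) := fun h => h.norm
  have E1 : (∑' n, t n) * ∑' n, a n = (∑' n, a n) - 1 := by
    rw [tsum_mul_tsum_eq_tsum_sum_antidiagonal_of_summable_norm (nrm sT) (nrm sA)]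
    simp_rw [hconv]
    exact sumA'.tsum_eq
  have snT : HasSum (fun n : ℕ => n * t n) ((∑' n, a n) - 1) := by
    simp_rw [ntA]; exact sumA'
  have E2 : ((∑' n, a n) - 1) * (∑' n, a n) + (∑' n, t n) * (∑' n : ℕ, n * a n)
      = ∑' n : ℕ, n * a n := by
    rw [← snT.tsum_eq, tsum_mul_tsum_eq_tsum_sum_antidiagonal_of_summable_norm (nrm snT.summable) (nrm sA),
      tsum_mul_tsum_eq_tsum_sum_antidiagonal_of_summable_norm (nrm sT) (nrm sB)]
    rw [← Summable.tsum_add]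
    · congr 1
      ext n
      rw [← Finset.sum_add_distrib]
      have : (n : ℝ) * a n = n * if n = 0 then 0 else a n := by
        split_ifs with h <;> simp [h]
      rw [this, ← hconv, Finset.mul_sum]
      apply Finset.sum_congr rfl
      intro p hp
      have hp' : p.1 + p.2 = n := by simpa using hp
      rw [← hp']; push_cast; ring
    · exact summable_sum_mul_antidiagonal_of_summable_norm' (f := fun n : ℕ => (n : ℝ) * t n) (g := a) (nrm snT.summable) snT.summable (nrm sA) sA
    · exact summable_sum_mul_antidiagonal_of_summable_norm' (f := t) (g := fun n : ℕ => (n : ℝ) * a n) (nrm sT) sT (nrm sB) sB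
  rw [hT.tsum_eq] at E1 E2
  have hl : 1 - l ≠ 0 := by linarith
  have A1 : ∑' n, a n = 1 / (1 - l) := by
    rw [eq_div_iff hl]; linarith
  have B1 : ∑' n : ℕ, n * a n = l / (1 - l) ^ 3 := by
    rw [A1] at E2
    have : (∑' n : ℕ, n * a n) * (1 - l) = (1 / (1 - l) - 1) * (1 / (1 - l)) := by linarith
    rw [← mul_left_inj' hl, this]
    field_simp
    ring
  exact ⟨A1 ▸ sA.hasSum, B1 ▸ sB.hasSum⟩

lemma borel_sums (l : ℝ) (hl0 : 0 ≤ l) (hl1 : l < 1) (p : ℕ → ℝ)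
    (hp : ∀ n : ℕ, p n = Real.exp (-(l * (n + 1))) * (l * (n + 1)) ^ n / (Nat.factorial (n + 1)))
    (h1 : HasSum p 1) :
    HasSum (fun n : ℕ => p n * (n + 1)) (1 / (1 - l)) ∧
    HasSum (fun n : ℕ => p n * (n + 1) ^ 2) (1 / (1 - l) ^ 3) := by
  rcases hl0.eq_or_lt with h | hpos
  · have hp0 : ∀ n, n ≠ 0 → p n = 0 := by
      intro n hn; rw [hp, ← h]; simp [hn]
    have hp00 : p 0 = 1 := by rw [hp, ← h]; simp
    constructor
    · convert hasSum_single (f := fun n : ℕ => p n * (n + 1)) 0 ?_ using 1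
      · simp [hp00, ← h]
      · intro n hn; simp [hp0 n hn]
    · convert hasSum_single (f := fun n : ℕ => p n * (n + 1) ^ 2) 0 ?_ using 1
      · simp [hp00, ← h]
      · intro n hn; simp [hp0 n hn]
  · have hl : l ≠ 0 := hpos.ne'
    have hl' : 1 - l ≠ 0 := by linarith
    have hpt : ∀ n : ℕ, l * p n = treeT (n + 1) * (l * Real.exp (-l)) ^ (n + 1) := by
      intro n
      have : Real.exp (-(l * (n + 1))) = Real.exp (-l) ^ (n + 1) := by
        rw [← Real.exp_nat_mul]; push_cast; ring_nf
      rw [hp, this]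
      simp only [treeT, if_neg (Nat.succ_ne_zero n), Nat.add_sub_cancel]
      push_cast
      rw [mul_pow, mul_pow, pow_succ l]; ring
    have hT : HasSum (fun n : ℕ => treeT n * (l * Real.exp (-l)) ^ n) l := by
      rw [← hasSum_nat_add_iff' 1]
      simp_rw [← hpt]
      simpa [treeT] using h1.mul_left l
    have hta : ∀ n : ℕ, ((n + 1 : ℕ) : ℝ) ^ (n + 1) / (Nat.factorial (n + 1) : ℝ)
        * (l * Real.exp (-l)) ^ (n + 1) = l * (p n * (n + 1)) := by
      intro n
      rw [← mul_assoc, hpt]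
      simp only [treeT, if_neg (Nat.succ_ne_zero n), Nat.add_sub_cancel]
      push_cast
      rw [pow_succ ((n : ℝ) + 1)]; ring
    obtain ⟨hA, hB⟩ := tree_sums l _ hl0 hl1 rfl hT
    rw [← hasSum_nat_add_iff' 1] at hA hB
    simp_rw [hta] at hA hB
    constructor
    · have := hA.mul_left l⁻¹
      refine hasSum_of_eq this (fun n => ?_) ?_
      · field_simp
      · simp; field_simp; ring
    · have := hB.mul_left l⁻¹
      refine hasSum_of_eq this (fun n => ?_) ?_
      · push_cast; field_simp
      · simp; field_simp

lemma integral_nat (ν : Measure ℕ) [IsFiniteMeasure ν] (p : ℕ → ℝ) (hp : ∀ n, ν.real {n} = p n)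
    (f : ℕ → ℝ) (s : ℝ) (hf : ∀ n, 0 ≤ f n) (h : HasSum (fun n => p n * f n) s) :
    Integrable f ν ∧ ∫ n, f n ∂ν = s := by
  have hi : Integrable f ν := by
    rw [← Measure.sum_smul_dirac ν]
    refine integrable_sum_dirac (fun i => measure_ne_top _ _) ?_
    convert h.summable using 2 with n
    rw [← hp, Real.norm_of_nonneg (hf n)]; rfl
  refine ⟨hi, ?_⟩
  rw [integral_countable hi]
  simp_rw [hp, smul_eq_mul]
  exact h.tsum_eq

/-- Asymptotic variance of the test statistic under the shifted Borel model. -/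
theorem shifted_borel_asymptotic_variance {Ω : Type*} [MeasurableSpace Ω]
    (P : Measure Ω) [IsProbabilityMeasure P]
    (μ : ℝ) (hμ : 0 ≤ μ) (X : Ω → ℕ) (hX : Measurable X)
    (hdist : ∀ n : ℕ, P {ω | X ω = n}
      = ENNReal.ofReal (Real.exp (-(μ / (1 + μ) * (n + 1)))
          * (μ / (1 + μ) * (n + 1)) ^ n / (Nat.factorial (n + 1)))) :
    variance (fun ω =>
        (-(Real.exp (-(μ / (1 + μ))) / (1 + μ) ^ 2)) * (X ω : ℝ)
          - (if X ω = 0 then (1:ℝ) else 0)) P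
      = Real.exp (-(2 * μ) / (1 + μ))
          * (Real.exp (μ / (1 + μ)) - 1 - μ / (1 + μ) ^ 2) := by
  have hpos : 0 < 1 + μ := by linarith
  set l := μ / (1 + μ) with hl
  have hl0 : 0 ≤ l := by positivity
  have hl1 : 1 - l = 1 / (1 + μ) := by rw [hl]; field_simp; ring
  have hl1' : l < 1 := by have : 0 < 1 / (1 + μ) := by positivity
                          linarith
  set p : ℕ → ℝ := fun n => Real.exp (-(l * (n + 1))) * (l * (n + 1)) ^ n / (Nat.factorial (n + 1))
    with hpdef
  have hp0 : ∀ n, 0 ≤ p n := fun n => by simp only [hpdef]; positivity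
  set ν := P.map X with hν
  have : IsProbabilityMeasure ν := Measure.isProbabilityMeasure_map hX.aemeasurable
  have hνp : ∀ n, ν.real {n} = p n := by
    intro n
    rw [measureReal_def, hν, Measure.map_apply hX (measurableSet_singleton n)]
    have : X ⁻¹' {n} = {ω | X ω = n} := rfl
    rw [this, hdist, ENNReal.toReal_ofReal (hp0 n)]
  have h1 : HasSum p 1 := by
    have hi : Integrable (fun _ : ℕ => (1 : ℝ)) ν := integrable_const _
    have hs : Summable p := by
      rw [← Measure.sum_smul_dirac ν] at hi
      have := hi.summable_of_dirac
      convert this using 2 with n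
      rw [← hνp]; simp [measureReal_def]
    have h := integral_countable hi
    simp only [integral_const, probReal_univ, smul_eq_mul, mul_one, hνp] at h
    rw [h]; exact hs.hasSum
  obtain ⟨hA, hB⟩ := borel_sums l hl0 hl1' p (fun n => rfl) h1
  have h0 : HasSum (fun n : ℕ => p n * (if n = 0 then (1:ℝ) else 0)) (Real.exp (-l)) := by
    convert hasSum_single (f := fun n : ℕ => p n * (if n = 0 then (1:ℝ) else 0)) 0 ?_ using 1
    · simp [hpdef]
    · intro n hn; simp [hn]
  have hM1 : HasSum (fun n : ℕ => p n * (n : ℝ)) (1 / (1 - l) - 1) := by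
    refine hasSum_of_eq (hA.sub h1) (fun n => ?_) rfl
    ring
  have hM2 : HasSum (fun n : ℕ => p n * (n : ℝ) ^ 2) (1 / (1 - l) ^ 3 - 2 * (1 / (1 - l)) + 1) := by
    refine hasSum_of_eq ((hB.sub (hA.mul_left 2)).add h1) (fun n => ?_) rfl
    ring
  obtain ⟨i0, e0⟩ := integral_nat ν p hνp _ _ (fun n => by split_ifs <;> simp) h0
  obtain ⟨i1, e1⟩ := integral_nat ν p hνp _ _ (fun n => by positivity) hM1
  obtain ⟨i2, e2⟩ := integral_nat ν p hνp _ _ (fun n => by positivity) hM2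
  set c := -(Real.exp (-l) / (1 + μ) ^ 2) with hc
  set g : ℕ → ℝ := fun n => c * (n : ℝ) - (if n = 0 then (1:ℝ) else 0) with hg
  have hmeas : Measurable g := measurable_from_top
  have hvar : variance (fun ω => c * (X ω : ℝ) - (if X ω = 0 then (1:ℝ) else 0)) P
      = variance g ν := by
    rw [hν, variance_map hmeas.aemeasurable hX.aemeasurable]; rfl
  have hg2 : (fun n => g n ^ 2) = fun n : ℕ => c ^ 2 * (n : ℝ) ^ 2 + (if n = 0 then (1:ℝ) else 0) := by
    ext n
    by_cases h : n = 0 <;> simp [hg, h, mul_pow]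
  have ig2 : Integrable (fun n => g n ^ 2) ν := by
    rw [hg2]; exact (i2.const_mul _).add i0
  have eg2 : ∫ n, g n ^ 2 ∂ν = c ^ 2 * (1 / (1 - l) ^ 3 - 2 * (1 / (1 - l)) + 1) + Real.exp (-l) := by
    rw [hg2, integral_add (i2.const_mul _) i0, integral_const_mul, e2, e0]
  have eg : ∫ n, g n ∂ν = c * (1 / (1 - l) - 1) - Real.exp (-l) := by
    rw [hg, integral_sub (i1.const_mul _) i0, integral_const_mul, e1, e0]
  have hL2 : MemLp g 2 ν := (memLp_two_iff_integrable_sq hmeas.aestronglyMeasurable).2 ig2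
  rw [hvar, variance_eq_sub hL2]
  have : ∫ n, (g ^ 2) n ∂ν = ∫ n, g n ^ 2 ∂ν := rfl
  rw [this, eg2, eg, hl1, hc]
  have x1 : Real.exp (-(2 * μ) / (1 + μ)) = Real.exp (-l) ^ 2 := by
    rw [← Real.exp_nat_mul, hl]; congr 1; push_cast; ring
  have x2 : Real.exp l * Real.exp (-l) = 1 := by rw [← Real.exp_add]; simp
  rw [x1]
  have x3 : Real.exp (-l) ^ 2 * (Real.exp l - 1 - μ / (1 + μ) ^ 2)
      = Real.exp (-l) - Real.exp (-l) ^ 2 * (1 + μ / (1 + μ) ^ 2) := by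
    linear_combination Real.exp (-l) * x2
  rw [x3]
  field_simp
  ring
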